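/- arXiv:2406.02371 — 4 statements merged into one kernel-verified Lean document; each statement's English description precedes it below -/
import Mathlib

section
/- Let k ≥ 1 and N > k be integers, let q ≥ N+1, and let c : Finset (Fin q) → ℕ satisfy conditions (i)–(iv) of the abstract codimension setup. Then there exists a subset Γ ⊆ Fin q with #Γ ≥ q − ⌈(N−k)τ/(τ−1)⌉ + 1 such that for every nonempty subset Γ' ⊆ Γ with c(Γ') ≤ k one has #Γ' ≤ τ · c(Γ'), where τ = τ(N,k). -/
/-- The constant `τ(N,k)` from the paper: `1 + √((N−k)/(k+1))` if `N < (5k+1)/4`,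
and `1 + 2(N−k)/(k+1)` otherwise. -/
noncomputable def tau (N k : ℕ) : ℝ :=
  if 4 * N < 5 * k + 1 then 1 + Real.sqrt (((N : ℝ) - k) / (k + 1))
  else 1 + 2 * ((N : ℝ) - k) / (k + 1)

theorem Finset.le_card_of_union_le_add {α : Type*} [DecidableEq α] {c : Finset α → ℕ}
    (hempty : c ∅ = 0) (hsingle : ∀ i, c {i} = 1)
    (hsubadd : ∀ s t, c (s ∪ t) ≤ c s + c t) (s : Finset α) : c s ≤ s.card := by
  induction s using Finset.induction_on with
  | empty => simp [hempty]
  | insert a s ha ih =>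
    rw [Finset.card_insert_of_notMem ha, Finset.insert_eq]
    have := hsubadd {a} s
    have := hsingle a
    omega

/-- A family of codimension at most `k` exceeds its codimension by at most `N - k`. -/
theorem Finset.card_add_le_of_subgeneral {α : Type*} [Fintype α] [DecidableEq α] {k N : ℕ}
    (hq : N + 1 ≤ Fintype.card α) {c : Finset α → ℕ}
    (hempty : c ∅ = 0) (hsingle : ∀ i, c {i} = 1)
    (hsubadd : ∀ s t, c (s ∪ t) ≤ c s + c t)
    (hsubgen : ∀ s : Finset α, N + 1 ≤ s.card → c s = k + 1)
    {s : Finset α} (hs : c s ≤ k) : s.card + k ≤ c s + N := by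
  have hcard : s.card ≤ N + 1 := by
    by_contra! h
    have := hsubgen s h.le
    omega
  obtain ⟨t, hst, ht⟩ := Finset.exists_superset_card_eq hcard hq
  have h₁ := hsubadd s (t \ s)
  rw [Finset.union_sdiff_of_subset hst, hsubgen t ht.ge] at h₁
  have h₂ := Finset.le_card_of_union_le_add hempty hsingle hsubadd (t \ s)
  rw [Finset.card_sdiff_of_subset hst] at h₂
  omega

theorem one_lt_tau {N k : ℕ} (hNk : k < N) : 1 < tau N k := by
  have : (0 : ℝ) < N - k := sub_pos.2 (by exact_mod_cast hNk)
  unfold tau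
  split_ifs <;> exact lt_add_of_pos_right 1 (by positivity)

theorem two_mul_sub_le_mul_tau_sub_one {N k : ℕ} (hNk : k < N) :
    2 * ((N : ℝ) - k) ≤ (k + 1) * (tau N k - 1) := by
  have hm : (0 : ℝ) < N - k := sub_pos.2 (by exact_mod_cast hNk)
  have hk : (0 : ℝ) < (k : ℝ) + 1 := by positivity
  unfold tau
  split_ifs with h
  · have h' : (4 : ℝ) * N < 5 * k + 1 := by exact_mod_cast h
    rw [add_sub_cancel_left, mul_comm ((k : ℝ) + 1), ← div_le_iff₀ hk]
    apply Real.le_sqrt_of_sq_le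
    rw [div_pow, div_le_div_iff₀ (by positivity) hk]
    nlinarith [mul_pos (mul_pos hm hk) (show (0 : ℝ) < k + 1 - 4 * (N - k) by linarith)]
  · rw [add_sub_cancel_left, mul_div_cancel₀ _ hk.ne']

/-- Main combinatorial lemma: under the abstract codimension axioms (i)–(iv) there is a
subset `Γ` of cardinality at least `q − ⌈(N−k)τ/(τ−1)⌉ + 1` such that every nonempty
`Γ' ⊆ Γ` with `c Γ' ≤ k` satisfies `#Γ' ≤ τ · c Γ'`. -/
theorem abstract_codim_main_lemma (k N q : ℕ) (hk : 1 ≤ k) (hNk : k < N) (hq : N + 1 ≤ q)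
    (c : Finset (Fin q) → ℕ)
    (hempty : c ∅ = 0) (hsingle : ∀ i : Fin q, c {i} = 1)
    (hbound : ∀ Γ : Finset (Fin q), Γ.Nonempty → 1 ≤ c Γ ∧ c Γ ≤ k + 1)
    (hsubadd : ∀ Γ Γ' : Finset (Fin q), c (Γ ∪ Γ') ≤ c Γ + c Γ')
    (hsubgen : ∀ Γ : Finset (Fin q), N + 1 ≤ Γ.card → c Γ = k + 1) :
    ∃ Γ : Finset (Fin q),
      (q : ℤ) - ⌈(((N : ℝ) - k) * tau N k) / (tau N k - 1)⌉ + 1 ≤ (Γ.card : ℤ) ∧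
      ∀ Γ' ⊆ Γ, Γ'.Nonempty → c Γ' ≤ k → (Γ'.card : ℝ) ≤ tau N k * c Γ' := by
  have hm : (0 : ℝ) < N - k := sub_pos.2 (by exact_mod_cast hNk)
  have hτ := one_lt_tau hNk
  have hτ' := two_mul_sub_le_mul_tau_sub_one hNk
  set τ := tau N k
  let P : Finset (Fin q) → Prop := fun B => c B ≤ k ∧ (B = ∅ ∨ τ * c B < B.card)
  have hexcess : ∀ B, c B ≤ k → (B.card : ℝ) + k ≤ c B + N := fun B hB => by
    exact_mod_cast Finset.card_add_le_of_subgeneral (by simpa using hq)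
      hempty hsingle hsubadd hsubgen hB
  have hcodim : ∀ B, P B → c B * (τ - 1) < N - k := by
    rintro B ⟨hB, rfl | hlt⟩
    · simpa [hempty] using hm
    · linarith [hexcess B hB]
  classical
  obtain ⟨U, hU, hmax⟩ := Finset.exists_max_image (Finset.univ.filter P) Finset.card
    ⟨∅, by simp [P, hempty]⟩
  replace hU : P U := by simpa using hU
  refine ⟨Uᶜ, ?_, fun B hBU hBne hBk => ?_⟩
  · have hlt : (U.card : ℝ) < (N - k) * τ / (τ - 1) := by
      rw [lt_div_iff₀ (sub_pos.2 hτ)]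
      nlinarith [hexcess U hU.1, hcodim U hU]
    have hceil : (U.card : ℤ) < ⌈((N : ℝ) - k) * τ / (τ - 1)⌉ :=
      Int.lt_ceil.2 (by exact_mod_cast hlt)
    have hcompl := Finset.card_add_card_compl U
    rw [Fintype.card_fin] at hcompl
    omega
  · by_contra! hBτ
    have hdisj : Disjoint U B := Finset.disjoint_left.2 fun x hxU hxB =>
      Finset.mem_compl.1 (hBU hxB) hxU
    have hcard : (U ∪ B).card = U.card + B.card := Finset.card_union_of_disjoint hdisj
    have hsum : c U + c B < k + 1 := by
      have : ((c U : ℝ) + c B) < k + 1 :=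
        lt_of_mul_lt_mul_right (by linarith [hcodim U hU, hcodim B ⟨hBk, .inr hBτ⟩])
          (sub_pos.2 hτ).le
      exact_mod_cast this
    have hsub : (c (U ∪ B) : ℝ) ≤ c U + c B := by exact_mod_cast hsubadd U B
    have hUτ : τ * c U ≤ U.card := by
      rcases hU.2 with rfl | h
      · simp [hempty]
      · exact h.le
    have hUB : P (U ∪ B) := by
      refine ⟨(hsubadd U B).trans (by omega), .inr ?_⟩
      rw [hcard, Nat.cast_add]
      nlinarith
    have := hmax _ (by simpa using hUB)
    have := hBne.card_pos
    omega
end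

section
/- Let k ≥ 1 and N > k be integers, let q ≥ N+1, and let c : Finset (Fin q) → ℕ satisfy conditions (i)–(iv) of the abstract codimension setup. Let S be the collection of all nonempty subsets Γ ⊆ Fin q with c(Γ) ≤ k and #Γ > τ(N,k) · c(Γ). If Γ₁ ∈ S has maximal cardinality among the members of S, then Γ₁ ∩ Γ₂ ≠ ∅ for every Γ₂ ∈ S. -/
/-- In both branches of its definition, `τ(N,k)` is at least `1 + 2(N−k)/(k+1)`. -/
theorem two_mul_sub_le_tau_sub_one_mul (k N : ℕ) (hNk : k < N) :
    2 * ((N : ℝ) - k) ≤ (tau N k - 1) * (k + 1) := by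
  have hk : (0 : ℝ) < k + 1 := by positivity
  have hn : (0 : ℝ) < (N : ℝ) - k := sub_pos.mpr (by exact_mod_cast hNk)
  unfold tau
  split_ifs with h
  · have h' : 4 * (N : ℝ) < 5 * k + 1 := by exact_mod_cast h
    have hx : 2 * ((N : ℝ) - k) / (k + 1) ≤ √(((N : ℝ) - k) / (k + 1)) := by
      apply Real.le_sqrt_of_sq_le
      rw [div_pow, div_le_div_iff₀ (by positivity) hk]
      nlinarith [mul_pos (mul_pos hn hk) (show (0 : ℝ) < k + 1 - 4 * (N - k) by linarith)]
    rw [div_le_iff₀ hk] at hx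
    linarith
  · rw [add_sub_cancel_left, div_mul_cancel₀ _ hk.ne']

/-- A subadditive function which is at most one on singletons and vanishes on `∅` is bounded
by the cardinality. -/
theorem le_card_of_subadditive {α : Type*} [DecidableEq α] (c : Finset α → ℕ)
    (hempty : c ∅ = 0) (hsingle : ∀ i, c {i} ≤ 1)
    (hsubadd : ∀ Γ Γ' : Finset α, c (Γ ∪ Γ') ≤ c Γ + c Γ') (Γ : Finset α) :
    c Γ ≤ Γ.card := by
  induction Γ using Finset.induction_on with
  | empty => simp [hempty]
  | insert a s ha ih =>
    rw [Finset.card_insert_of_notMem ha, Finset.insert_eq]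
    have := hsubadd {a} s
    have := hsingle a
    omega

/-- If `c` takes the value `k + 1` on all sets with more than `N` elements, then the excess
`#Γ - c Γ` of a set with `c Γ ≤ k` is at most `N - k`. -/
theorem card_add_le_of_subadditive {α : Type*} [Fintype α] [DecidableEq α] (k N : ℕ)
    (hq : N + 1 ≤ Fintype.card α) (c : Finset α → ℕ)
    (hempty : c ∅ = 0) (hsingle : ∀ i, c {i} ≤ 1)
    (hsubadd : ∀ Γ Γ' : Finset α, c (Γ ∪ Γ') ≤ c Γ + c Γ')
    (hsubgen : ∀ Γ : Finset α, N + 1 ≤ Γ.card → c Γ = k + 1)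
    (Γ : Finset α) (hΓ : c Γ ≤ k) : Γ.card + k ≤ c Γ + N := by
  have hcard : Γ.card ≤ N + 1 := by
    by_contra! h
    have := hsubgen Γ h.le
    omega
  obtain ⟨Δ, hsub, hΔ⟩ := Finset.exists_superset_card_eq hcard hq
  have h1 := hsubgen Δ hΔ.ge
  have h2 := hsubadd Γ (Δ \ Γ)
  rw [Finset.union_sdiff_of_subset hsub] at h2
  have h3 := le_card_of_subadditive c hempty hsingle hsubadd (Δ \ Γ)
  rw [Finset.card_sdiff_of_subset hsub] at h3
  omega

/-- If `Γ₁` is a member of maximal cardinality of the family `S` of all nonempty subsets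
`Γ` with `c Γ ≤ k` and `#Γ > τ(N,k)·c Γ`, then `Γ₁` meets every member of `S`. -/
theorem abstract_codim_claim (k N q : ℕ) (hk : 1 ≤ k) (hNk : k < N) (hq : N + 1 ≤ q)
    (c : Finset (Fin q) → ℕ)
    (hempty : c ∅ = 0) (hsingle : ∀ i : Fin q, c {i} = 1)
    (hbound : ∀ Γ : Finset (Fin q), Γ.Nonempty → 1 ≤ c Γ ∧ c Γ ≤ k + 1)
    (hsubadd : ∀ Γ Γ' : Finset (Fin q), c (Γ ∪ Γ') ≤ c Γ + c Γ')
    (hsubgen : ∀ Γ : Finset (Fin q), N + 1 ≤ Γ.card → c Γ = k + 1)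
    (S : Set (Finset (Fin q)))
    (hS : S = {Γ : Finset (Fin q) | Γ.Nonempty ∧ c Γ ≤ k ∧ tau N k * c Γ < (Γ.card : ℝ)})
    (Γ₁ : Finset (Fin q)) (hΓ₁ : Γ₁ ∈ S)
    (hmax : ∀ Γ ∈ S, Γ.card ≤ Γ₁.card)
    (Γ₂ : Finset (Fin q)) (hΓ₂ : Γ₂ ∈ S) :
    (Γ₁ ∩ Γ₂).Nonempty := by
  subst hS
  obtain ⟨hne₁, hc₁, ht₁⟩ := hΓ₁
  obtain ⟨hne₂, hc₂, ht₂⟩ := hΓ₂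
  by_contra hdisj
  rw [Finset.not_nonempty_iff_eq_empty, ← Finset.disjoint_iff_inter_eq_empty] at hdisj
  have htau := two_mul_sub_le_tau_sub_one_mul k N hNk
  have hk1 : (0 : ℝ) < k + 1 := by positivity
  have hn : (0 : ℝ) < (N : ℝ) - k := sub_pos.mpr (by exact_mod_cast hNk)
  have htau_pos : 0 < tau N k - 1 :=
    pos_of_mul_pos_left (lt_of_lt_of_le (by linarith) htau) hk1.le
  have hcard := card_add_le_of_subadditive k N (by simpa using hq) c hempty
    (fun i => (hsingle i).le) hsubadd hsubgen
  have hsum : c Γ₁ + c Γ₂ < k + 1 := by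
    have h₁ : (Γ₁.card : ℝ) + k ≤ c Γ₁ + N := by exact_mod_cast hcard Γ₁ hc₁
    have h₂ : (Γ₂.card : ℝ) + k ≤ c Γ₂ + N := by exact_mod_cast hcard Γ₂ hc₂
    have : (c Γ₁ + c Γ₂ : ℝ) < k + 1 :=
      lt_of_mul_lt_mul_left (by linarith) htau_pos.le
    exact_mod_cast this
  have hunion := hsubadd Γ₁ Γ₂
  have hcu := Finset.card_union_of_disjoint hdisj
  have hmem : tau N k * c (Γ₁ ∪ Γ₂) < ((Γ₁ ∪ Γ₂).card : ℝ) := by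
    have hle : (c (Γ₁ ∪ Γ₂) : ℝ) ≤ c Γ₁ + c Γ₂ := by exact_mod_cast hunion
    have := mul_le_mul_of_nonneg_left hle (show 0 ≤ tau N k by linarith)
    rw [hcu]
    push_cast
    linarith
  have := hmax (Γ₁ ∪ Γ₂) ⟨hne₁.mono Finset.subset_union_left, by omega, hmem⟩
  have := hne₂.card_pos
  omega
end

section
/- Let k ≥ 1 and N be integers with k+1 < N < (5k+1)/4, and let τ = 1 + √((N−k)/(k+1)). Then ⌈(N−k)τ/(τ−1)⌉ − 1 + τ(k+1) ≤ 2√((N−k)(k+1)) + N + 1 < (3/2)(2N − k + 1). -/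
/-- Comparison of the total defect bound with the bound of Heier–Levin when
`k+1 < N < (5k+1)/4` and `τ = 1 + √((N−k)/(k+1))`. -/
theorem defect_bound_small_N (k N : ℕ) (hk : 1 ≤ k) (hN : k + 1 < N) (hN2 : 4 * N < 5 * k + 1)
    (τ : ℝ) (hτ : τ = 1 + Real.sqrt (((N : ℝ) - k) / ((k : ℝ) + 1))) :
    (⌈(((N : ℝ) - k) * τ) / (τ - 1)⌉ : ℝ) - 1 + τ * ((k : ℝ) + 1) ≤
        2 * Real.sqrt (((N : ℝ) - k) * ((k : ℝ) + 1)) + (N : ℝ) + 1 ∧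
      2 * Real.sqrt (((N : ℝ) - k) * ((k : ℝ) + 1)) + (N : ℝ) + 1 <
        (3 / 2) * (2 * (N : ℝ) - (k : ℝ) + 1) := by
  have hb : (0 : ℝ) < (k : ℝ) + 1 := by positivity
  have ha : (0 : ℝ) < (N : ℝ) - k := by
    have : (k : ℝ) + 1 < N := by exact_mod_cast hN
    linarith
  have hab : 4 * ((N : ℝ) - k) < (k : ℝ) + 1 := by
    have : 4 * (N : ℝ) < 5 * k + 1 := by exact_mod_cast hN2
    linarith
  have hsum : ((N : ℝ) - k) + ((k : ℝ) + 1) = N + 1 := by ring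
  have hright : (3 / 2) * (2 * (N : ℝ) - (k : ℝ) + 1) =
      N + 1 + (2 * ((N : ℝ) - k) + ((k : ℝ) + 1) / 2) := by ring
  rw [hright]
  generalize (N : ℝ) - k = a at *
  generalize (k : ℝ) + 1 = b at *
  set t := √(a / b)
  have ht : 0 < t := Real.sqrt_pos.2 (div_pos ha hb)
  have hat : a = t ^ 2 * b := by
    rw [Real.sq_sqrt (div_pos ha hb).le, div_mul_cancel₀ _ hb.ne']
  have hs : √(a * b) = t * b := by
    rw [show a * b = (t * b) ^ 2 by rw [hat]; ring, Real.sqrt_sq (by positivity)]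
  have hquot : a * τ / (τ - 1) = a + t * b := by
    rw [hτ, add_sub_cancel_left, div_eq_iff ht.ne']
    linear_combination hat
  rw [hs, hquot]
  constructor
  · have := Int.ceil_lt_add_one (a + t * b)
    rw [hτ]
    linarith
  · have htlt : 2 * t < 1 := by
      have : (2 * t) ^ 2 < 1 := by
        refine lt_of_mul_lt_mul_right ?_ hb.le
        linarith
      exact lt_of_pow_lt_pow_left₀ 2 zero_le_one (by simpa using this)
    have := mul_pos hb (pow_pos (sub_pos.2 htlt) 2)
    linarith
end

section
/- Let k ≥ 1 and N be integers with N > k and N ≥ (5k+1)/4, and let τ = 1 + 2(N−k)/(k+1). Then ⌈(N−k)τ/(τ−1)⌉ − 1 + τ(k+1) ≤ 3N − 2k + ⌊k/2⌋ + 1. -/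
/-- Bound for the total defect when `N ≥ (5k+1)/4` and `τ = 1 + 2(N−k)/(k+1)`:
`⌈(N−k)τ/(τ−1)⌉ − 1 + τ(k+1) ≤ 3N − 2k + ⌊k/2⌋ + 1`. -/
theorem defect_bound_large_N (k N : ℕ) (hk : 1 ≤ k) (hNk : k < N) (hN : 5 * k + 1 ≤ 4 * N)
    (τ : ℝ) (hτ : τ = 1 + 2 * ((N : ℝ) - k) / ((k : ℝ) + 1)) :
    (⌈(((N : ℝ) - k) * τ) / (τ - 1)⌉ : ℝ) - 1 + τ * ((k : ℝ) + 1) ≤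
      3 * (N : ℝ) - 2 * (k : ℝ) + ((k / 2 : ℕ) : ℝ) + 1 := by
  have hk' : (0 : ℝ) < (k : ℝ) + 1 := by positivity
  have hd : (0 : ℝ) < (N : ℝ) - k := sub_pos.2 (by exact_mod_cast hNk)
  have hmul : τ * ((k : ℝ) + 1) = (k : ℝ) + 1 + 2 * ((N : ℝ) - k) := by
    rw [hτ]
    field_simp
  have hquot : (((N : ℝ) - k) * τ) / (τ - 1) = (N : ℝ) - k + ((k : ℝ) + 1) / 2 := by
    have hτ1 : τ - 1 = 2 * ((N : ℝ) - k) / ((k : ℝ) + 1) := by rw [hτ]; ring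
    have hpos : 0 < τ - 1 := by rw [hτ1]; positivity
    rw [div_eq_iff hpos.ne']
    linear_combination (-1 / 2 : ℝ) * hmul
  have hhalf : (k : ℝ) ≤ 2 * ((k / 2 : ℕ) : ℝ) + 1 := by
    exact_mod_cast (by omega : k ≤ 2 * (k / 2) + 1)
  have hceil : ⌈(((N : ℝ) - k) * τ) / (τ - 1)⌉ ≤ (N : ℤ) - k + ((k / 2 : ℕ) : ℤ) + 1 := by
    rw [hquot, Int.ceil_le]
    simp only [Int.cast_add, Int.cast_sub, Int.cast_natCast, Int.cast_one]
    linarith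
  have hceil' : (⌈(((N : ℝ) - k) * τ) / (τ - 1)⌉ : ℝ) ≤
      (N : ℝ) - k + ((k / 2 : ℕ) : ℝ) + 1 := by
    simpa only [Int.cast_add, Int.cast_sub, Int.cast_natCast, Int.cast_one] using
      (Int.cast_le (R := ℝ)).2 hceil
  linarith
end
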